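/- Fix ρ > 0. Let (u_k) be positive reals with u_k → 0, let (ε_k) be nonnegative reals with ε_k → 0, and let (x_k) be a sequence in E such that for every k, the gradient of x ↦ Q^lse(x, ρ, u_k) at x_{k+1} has norm at most ε_k. If x_k → x̄, where x̄ is feasible and LICQ holds at x̄, then x̄ satisfies the KKT conditions. -/

import Mathlib

open Filter Topology

lemma hasDerivAt_softplus {u : ℝ} (hu : u ≠ 0) (t : ℝ) :
    HasDerivAt (fun t => u * Real.log (1 + Real.exp (t / u)))
      (Real.exp (t / u) / (1 + Real.exp (t / u))) t := by
  have hpos : 1 + Real.exp (t / u) ≠ 0 := by positivity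
  have key := (((((hasDerivAt_id t).div_const u).exp).const_add 1).log hpos).const_mul u
  refine key.congr_deriv ?_
  simp only [id]
  field_simp

lemma hasDerivAt_log_exp_add_exp_neg {u : ℝ} (hu : u ≠ 0) (t : ℝ) :
    HasDerivAt (fun t => u * Real.log (Real.exp (t / u) + Real.exp (-t / u)))
      ((Real.exp (t / u) - Real.exp (-t / u)) / (Real.exp (t / u) + Real.exp (-t / u))) t := by
  have hpos : Real.exp (t / u) + Real.exp (-t / u) ≠ 0 := by positivity
  have key := (((((hasDerivAt_id t).div_const u).exp).add
    (((hasDerivAt_id t).neg.div_const u).exp)).log hpos).const_mul u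
  refine key.congr_deriv ?_
  simp only [id, Pi.neg_apply, Pi.add_apply]
  field_simp
  ring

lemma exp_div_one_add_exp_mem_Icc (s : ℝ) :
    Real.exp s / (1 + Real.exp s) ∈ Set.Icc (0 : ℝ) 1 := by
  refine ⟨by positivity, ?_⟩
  rw [div_le_one (by positivity)]
  linarith

lemma exp_sub_exp_div_mem_Icc (s t : ℝ) :
    (Real.exp s - Real.exp t) / (Real.exp s + Real.exp t) ∈ Set.Icc (-1 : ℝ) 1 := by
  have hs := Real.exp_pos s
  have ht := Real.exp_pos t
  constructor
  · rw [le_div_iff₀ (by positivity)]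
    linarith
  · rw [div_le_one (by positivity)]
    linarith

lemma tendsto_sigmoid_div_of_neg {a u : ℕ → ℝ} {c : ℝ} (hc : c < 0)
    (ha : Tendsto a atTop (𝓝 c)) (hupos : ∀ k, 0 < u k) (hu : Tendsto u atTop (𝓝 0)) :
    Tendsto (fun k => Real.exp (a k / u k) / (1 + Real.exp (a k / u k))) atTop (𝓝 0) := by
  have hinv : Tendsto (fun k => (u k)⁻¹) atTop atTop :=
    (tendsto_nhdsWithin_iff.2 ⟨hu, Eventually.of_forall hupos⟩).inv_tendsto_nhdsGT_zero
  have hbot : Tendsto (fun k => a k / u k) atTop atBot := by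
    simpa only [div_eq_mul_inv] using ha.neg_mul_atTop hc hinv
  have hexp : Tendsto (fun k => Real.exp (a k / u k)) atTop (𝓝 0) :=
    Real.tendsto_exp_atBot.comp hbot
  have hdiv := hexp.div (hexp.const_add 1) (by norm_num)
  rwa [zero_div] at hdiv

section Gradient

variable {E : Type*} [NormedAddCommGroup E] [InnerProductSpace ℝ E]

lemma gradient_lse_penalty [CompleteSpace E] {n m : ℕ} {f : E → ℝ} {g : Fin n → E → ℝ}
    {h : Fin m → E → ℝ} {x : E} (hf : DifferentiableAt ℝ f x)
    (hg : ∀ i, DifferentiableAt ℝ (g i) x) (hh : ∀ j, DifferentiableAt ℝ (h j) x)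
    (ρ : ℝ) {u : ℝ} (hu : u ≠ 0) :
    gradient (fun x => f x + ρ * (∑ i, u * Real.log (1 + Real.exp (g i x / u)))
        + ρ * ∑ j, u * Real.log (Real.exp (h j x / u) + Real.exp (-h j x / u))) x =
      gradient f x
        + ρ • (∑ i, (Real.exp (g i x / u) / (1 + Real.exp (g i x / u))) • gradient (g i) x)
        + ρ • ∑ j, ((Real.exp (h j x / u) - Real.exp (-h j x / u)) /
            (Real.exp (h j x / u) + Real.exp (-h j x / u))) • gradient (h j) x := by
  have hG := HasFDerivAt.fun_sum (u := Finset.univ) fun i _ =>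
    (hasDerivAt_softplus hu (g i x)).comp_hasFDerivAt x (hg i).hasFDerivAt
  have hH := HasFDerivAt.fun_sum (u := Finset.univ) fun j _ =>
    (hasDerivAt_log_exp_add_exp_neg hu (h j x)).comp_hasFDerivAt x (hh j).hasFDerivAt
  have hQ := (hf.hasFDerivAt.add (hG.const_mul ρ)).add (hH.const_mul ρ)
  have hQ' := hQ.fderiv
  unfold gradient
  refine (congrArg (InnerProductSpace.toDual ℝ E).symm hQ').trans ?_
  simp [map_sum]

lemma ContDiff.continuous_gradient [CompleteSpace E] {f : E → ℝ} {r : WithTop ℕ∞}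
    (hf : ContDiff ℝ r f) (hr : r ≠ 0) : Continuous (gradient f) :=
  (InnerProductSpace.toDual ℝ E).symm.continuous.comp (hf.continuous_fderiv hr)

end Gradient

theorem stmt_4
    {E : Type*} [NormedAddCommGroup E] [InnerProductSpace ℝ E] [FiniteDimensional ℝ E]
    {n m : ℕ} (f : E → ℝ) (g : Fin n → E → ℝ) (h : Fin m → E → ℝ)
    (hf : ContDiff ℝ 2 f) (hg : ∀ i, ContDiff ℝ 2 (g i)) (hh : ∀ j, ContDiff ℝ 2 (h j))
    (ρ : ℝ) (hρ : 0 < ρ)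
    (Q : E → ℝ → ℝ)
    (hQ : ∀ x u, Q x u =
      f x + ρ * (∑ i, u * Real.log (1 + Real.exp (g i x / u)))
        + ρ * ∑ j, u * Real.log (Real.exp (h j x / u) + Real.exp (-h j x / u)))
    (u : ℕ → ℝ) (hupos : ∀ k, 0 < u k) (hu : Tendsto u atTop (𝓝 0))
    (ε : ℕ → ℝ) (hεnn : ∀ k, 0 ≤ ε k) (hε : Tendsto ε atTop (𝓝 0))
    (x : ℕ → E)
    (hgrad : ∀ k, ‖gradient (fun y => Q y (u k)) (x (k + 1))‖ ≤ ε k)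
    (xbar : E) (hx : Tendsto x atTop (𝓝 xbar))
    (hxbarfeas : (∀ i, g i xbar ≤ 0) ∧ ∀ j, h j xbar = 0)
    (hLICQ : LinearIndependent ℝ
      (Sum.elim (fun i : {i : Fin n // g i xbar = 0} => gradient (g i.1) xbar)
        (fun j : Fin m => gradient (h j) xbar))) :
    ∃ (lams : Fin n → ℝ) (gams : Fin m → ℝ),
      (∀ i, 0 ≤ lams i) ∧ (∀ i, lams i * g i xbar = 0) ∧
      gradient f xbar + (∑ i, lams i • gradient (g i) xbar)
        + (∑ j, gams j • gradient (h j) xbar) = 0 := by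
  have h2 : (2 : WithTop ℕ∞) ≠ 0 := two_ne_zero
  have hy : Tendsto (fun k => x (k + 1)) atTop (𝓝 xbar) := (tendsto_add_atTop_iff_nat 1).2 hx
  let a : ℕ → Fin n → ℝ := fun k i =>
    Real.exp (g i (x (k + 1)) / u k) / (1 + Real.exp (g i (x (k + 1)) / u k))
  let b : ℕ → Fin m → ℝ := fun k j =>
    (Real.exp (h j (x (k + 1)) / u k) - Real.exp (-h j (x (k + 1)) / u k)) /
      (Real.exp (h j (x (k + 1)) / u k) + Real.exp (-h j (x (k + 1)) / u k))
  have hres : ∀ k, ‖gradient f (x (k + 1)) + ρ • (∑ i, a k i • gradient (g i) (x (k + 1)))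
      + ρ • ∑ j, b k j • gradient (h j) (x (k + 1))‖ ≤ ε k := fun k => by
    have hk := hgrad k
    simp only [hQ] at hk
    rwa [gradient_lse_penalty (hf.differentiable h2 _) (fun i => (hg i).differentiable h2 _)
      (fun j => (hh j).differentiable h2 _) ρ (hupos k).ne'] at hk
  have hmem : ∀ k, (a k, b k) ∈
      Set.Icc (0 : Fin n → ℝ) 1 ×ˢ Set.Icc (-1 : Fin m → ℝ) 1 := fun k =>
    ⟨⟨fun i => (exp_div_one_add_exp_mem_Icc _).1, fun i => (exp_div_one_add_exp_mem_Icc _).2⟩,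
      ⟨fun j => (exp_sub_exp_div_mem_Icc _ _).1, fun j => (exp_sub_exp_div_mem_Icc _ _).2⟩⟩
  obtain ⟨⟨α, β⟩, hαβ, φ, hφ, hlim⟩ := (isCompact_Icc.prod isCompact_Icc).tendsto_subseq hmem
  have hα : ∀ i, Tendsto (fun k => a (φ k) i) atTop (𝓝 (α i)) :=
    tendsto_pi_nhds.1 hlim.fst_nhds
  have hβ : ∀ j, Tendsto (fun k => b (φ k) j) atTop (𝓝 (β j)) :=
    tendsto_pi_nhds.1 hlim.snd_nhds
  have hyφ : Tendsto (fun k => x (φ k + 1)) atTop (𝓝 xbar) := hy.comp hφ.tendsto_atTop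
  refine ⟨fun i => ρ * α i, fun j => ρ * β j, fun i => mul_nonneg hρ.le (hαβ.1.1 i),
    fun i => ?_, ?_⟩
  · rcases (hxbarfeas.1 i).lt_or_eq with hneg | hzero
    · have h0 : Tendsto (fun k => a k i) atTop (𝓝 0) := tendsto_sigmoid_div_of_neg hneg
        (((hg i).continuous.tendsto xbar).comp hy) hupos hu
      have : α i = 0 := tendsto_nhds_unique (hα i) (h0.comp hφ.tendsto_atTop)
      simp [this]
    · simp [hzero]
  · have hgradlim := ((((hf.continuous_gradient h2).tendsto xbar).comp hyφ).add
      ((tendsto_finsetSum Finset.univ fun i _ => (hα i).smul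
        ((((hg i).continuous_gradient h2).tendsto xbar).comp hyφ)).const_smul ρ)).add
      ((tendsto_finsetSum Finset.univ fun j _ => (hβ j).smul
        ((((hh j).continuous_gradient h2).tendsto xbar).comp hyφ)).const_smul ρ)
    have hle := le_of_tendsto_of_tendsto' hgradlim.norm (hε.comp hφ.tendsto_atTop)
      fun k => hres (φ k)
    simpa only [Finset.smul_sum, smul_smul] using norm_le_zero_iff.1 hle
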